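/- Let n, r, t be integers with t ≥ 1 and n ≥ 2r+2t+2, let K_n = (V,E) be the complete graph on n vertices, and set p = t/C(n−2r,2). Define y : P_{r+1} → ℝ by y_A = Pr_{D_p}[X_q = 1 for all q ∈ A]. Then y lies in the level-r Sherali–Adams tightening S^{(r)}(P_t(K_n)): y_∅ = 1 and for all Y,N ⊆ V∪E with |Y∪N| ≤ r, with w_{Y,N} = ∑_{T⊆N}(−1)^{|T|} y_{Y∪T}, the following hold: (i) w_{Y∪{i},N} + w_{Y∪{j},N} ≥ w_{Y∪{e},N} for every edge e={i,j} ∈ E; (ii) ∑_{e∈E} w_{Y∪{e},N} ≥ t·w_{Y,N}; (iii) 0 ≤ w_{Y∪{q},N} ≤ w_{Y,N} for every q ∈ V∪E. -/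

import Mathlib

open Finset
open scoped Classical

noncomputable section

/-- The edges of the complete graph `K_n`: non-diagonal unordered pairs of `Fin n`. -/
abbrev EdgeT (n : ℕ) : Type := {e : Sym2 (Fin n) // ¬ e.IsDiag}

/-- The LP variables of the `t`-PVC relaxation on `K_n`: vertices ⊕ edges. -/
abbrev PVar (n : ℕ) : Type := Fin n ⊕ EdgeT n

/-- The 0-1 assignment determined by a set `S` of chosen vertices: a vertex variable is 1
iff the vertex is chosen, an edge variable is 1 iff the edge has a chosen endpoint. -/
def Xvar (n : ℕ) (q : PVar n) (S : Finset (Fin n)) : ℝ :=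
  match q with
  | Sum.inl i => if i ∈ S then 1 else 0
  | Sum.inr e => if ∃ i ∈ S, i ∈ e.1 then 1 else 0

/-- The probability, under the distribution `D_p` (each vertex chosen independently with
probability `p`), of the set of chosen vertices being exactly `S`. -/
def μD (n : ℕ) (p : ℝ) (S : Finset (Fin n)) : ℝ :=
  p ^ S.card * (1 - p) ^ (n - S.card)

/-- Expectation with respect to `D_p`. -/
def ED (n : ℕ) (p : ℝ) (f : Finset (Fin n) → ℝ) : ℝ :=
  ∑ S : Finset (Fin n), μD n p S * f S

/-- `y_A = Pr_{D_p}[X_q = 1 for all q ∈ A]`. -/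
def yD (n : ℕ) (p : ℝ) (A : Finset (PVar n)) : ℝ :=
  ∑ S : Finset (Fin n), if ∀ q ∈ A, Xvar n q S = 1 then μD n p S else 0

/-- The value `p = t / C(n - 2r, 2)`. -/
def pval (n r t : ℕ) : ℝ := (t : ℝ) / (Nat.choose (n - 2 * r) 2)

/-- The linearization `w_{Y,N} = ∑_{T ⊆ N} (-1)^{|T|} y_{Y ∪ T}`. -/
def wSA {α : Type*} [DecidableEq α] (y : Finset α → ℝ) (Y N : Finset α) : ℝ :=
  ∑ T ∈ N.powerset, (-1 : ℝ) ^ T.card * y (Y ∪ T)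

/-- Membership of `y` in the level-`r` Sherali–Adams tightening `S^{(r)}(P_t(K_n))` of
the `t`-partial-vertex-cover polytope of the complete graph `K_n`. -/
def SAmem (n t r : ℕ) (y : Finset (PVar n) → ℝ) : Prop :=
  y ∅ = 1 ∧
  ∀ Y N : Finset (PVar n), (Y ∪ N).card ≤ r →
    (∀ (e : EdgeT n) (i j : Fin n), e.1 = s(i, j) →
      wSA y (Y ∪ {Sum.inl i}) N + wSA y (Y ∪ {Sum.inl j}) N
        ≥ wSA y (Y ∪ {Sum.inr e}) N) ∧
    ((∑ e : EdgeT n, wSA y (Y ∪ {Sum.inr e}) N) ≥ (t : ℝ) * wSA y Y N) ∧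
    (∀ q : PVar n, 0 ≤ wSA y (Y ∪ {q}) N ∧ wSA y (Y ∪ {q}) N ≤ wSA y Y N)

lemma Xvar_eq_zero_or_one (n : ℕ) (q : PVar n) (S : Finset (Fin n)) :
    Xvar n q S = 0 ∨ Xvar n q S = 1 := by
  unfold Xvar
  split <;> split_ifs <;> simp

lemma Xvar_nonneg (n : ℕ) (q : PVar n) (S : Finset (Fin n)) : 0 ≤ Xvar n q S := by
  rcases Xvar_eq_zero_or_one n q S with h | h <;> simp [h]

lemma Xvar_le_one (n : ℕ) (q : PVar n) (S : Finset (Fin n)) : Xvar n q S ≤ 1 := by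
  rcases Xvar_eq_zero_or_one n q S with h | h <;> simp [h]

lemma prod_Xvar (n : ℕ) (A : Finset (PVar n)) (S : Finset (Fin n)) :
    ∏ q ∈ A, Xvar n q S = if ∀ q ∈ A, Xvar n q S = 1 then 1 else 0 := by
  split_ifs with h
  · exact Finset.prod_eq_one h
  · push Not at h
    obtain ⟨q, hq, hne⟩ := h
    exact Finset.prod_eq_zero hq ((Xvar_eq_zero_or_one n q S).resolve_right hne)

lemma prod_Xvar_union (n : ℕ) (A B : Finset (PVar n)) (S : Finset (Fin n)) :
    ∏ q ∈ A ∪ B, Xvar n q S = (∏ q ∈ A, Xvar n q S) * ∏ q ∈ B, Xvar n q S := by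
  simp only [prod_Xvar, Finset.forall_mem_union]
  split_ifs <;> simp_all

/-- The indicator of the event that all variables in `Y` are 1 and all those in `N` are 0. -/
def eventInd (n : ℕ) (Y N : Finset (PVar n)) (S : Finset (Fin n)) : ℝ :=
  (∏ q ∈ Y, Xvar n q S) * ∏ q ∈ N, (1 - Xvar n q S)

lemma eventInd_nonneg (n : ℕ) (Y N : Finset (PVar n)) (S : Finset (Fin n)) :
    0 ≤ eventInd n Y N S :=
  mul_nonneg (Finset.prod_nonneg fun q _ => Xvar_nonneg n q S)
    (Finset.prod_nonneg fun q _ => sub_nonneg.2 (Xvar_le_one n q S))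

lemma eventInd_union_singleton (n : ℕ) (Y N : Finset (PVar n)) (q : PVar n)
    (S : Finset (Fin n)) :
    eventInd n (Y ∪ {q}) N S = Xvar n q S * eventInd n Y N S := by
  rw [eventInd, eventInd, prod_Xvar_union, Finset.prod_singleton]
  ring

lemma yD_eq_ED (n : ℕ) (p : ℝ) (A : Finset (PVar n)) :
    yD n p A = ED n p fun S => ∏ q ∈ A, Xvar n q S := by
  simp only [yD, ED, prod_Xvar, mul_ite, mul_one, mul_zero]

lemma wSA_yD (n : ℕ) (p : ℝ) (Y N : Finset (PVar n)) :
    wSA (yD n p) Y N = ED n p (eventInd n Y N) := by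
  simp only [wSA, yD_eq_ED, ED, Finset.mul_sum]
  rw [Finset.sum_comm]
  refine Finset.sum_congr rfl fun S _ => ?_
  have h : ∏ q ∈ N, (1 - Xvar n q S)
      = ∑ T ∈ N.powerset, (-1 : ℝ) ^ T.card * ∏ q ∈ T, Xvar n q S := by
    have := Finset.prod_add (fun q => -Xvar n q S) (fun _ => (1 : ℝ)) N
    simpa [Finset.prod_neg, neg_add_eq_sub] using this
  rw [eventInd, h, Finset.mul_sum, Finset.mul_sum]
  refine Finset.sum_congr rfl fun T _ => ?_
  rw [prod_Xvar_union]
  ring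

lemma μD_nonneg {n : ℕ} {p : ℝ} (h0 : 0 ≤ p) (h1 : p ≤ 1) (S : Finset (Fin n)) :
    0 ≤ μD n p S :=
  mul_nonneg (pow_nonneg h0 _) (pow_nonneg (sub_nonneg.2 h1) _)

lemma ED_mono {n : ℕ} {p : ℝ} (h0 : 0 ≤ p) (h1 : p ≤ 1) {f g : Finset (Fin n) → ℝ}
    (h : ∀ S, f S ≤ g S) : ED n p f ≤ ED n p g :=
  Finset.sum_le_sum fun S _ => mul_le_mul_of_nonneg_left (h S) (μD_nonneg h0 h1 S)

lemma ED_nonneg {n : ℕ} {p : ℝ} (h0 : 0 ≤ p) (h1 : p ≤ 1) {f : Finset (Fin n) → ℝ}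
    (h : ∀ S, 0 ≤ f S) : 0 ≤ ED n p f :=
  Finset.sum_nonneg fun S _ => mul_nonneg (μD_nonneg h0 h1 S) (h S)

lemma yD_empty (n : ℕ) (p : ℝ) : yD n p ∅ = 1 := by
  have h := Finset.sum_pow_mul_eq_add_pow p (1 - p) (Finset.univ : Finset (Fin n))
  simpa [yD, μD] using h

/-- A vertex is chosen independently of any function that ignores it. -/
lemma ED_mul_mem (n : ℕ) (p : ℝ) (i : Fin n) (f : Finset (Fin n) → ℝ)
    (hf : ∀ S, i ∉ S → f (insert i S) = f S) :
    ED n p (fun S => (if i ∈ S then 1 else 0) * f S) = p * ED n p f := by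
  have key : ∀ g : Finset (Fin n) → ℝ, ∑ S, g S
      = ∑ S ∈ (Finset.univ.erase i).powerset, (g S + g (insert i S)) := by
    intro g
    rw [← Finset.powerset_univ, ← Finset.insert_erase (Finset.mem_univ i),
      Finset.sum_powerset_insert (Finset.notMem_erase i _), Finset.sum_add_distrib,
      Finset.insert_erase (Finset.mem_univ i)]
  rw [ED, ED, key, key, Finset.mul_sum]
  refine Finset.sum_congr rfl fun S hS => ?_
  have hi : i ∉ S := fun h => by simpa using Finset.mem_powerset.1 hS h
  have hlt : S.card < n := by
    simpa [hi] using (S.card_lt_univ_of_notMem hi)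
  obtain ⟨k, hk⟩ : ∃ k, n - S.card = k + 1 := ⟨n - S.card - 1, by omega⟩
  have hk' : n - (S.card + 1) = k := by omega
  simp only [hi, if_false, Finset.mem_insert_self, if_true, hf S hi, μD,
    Finset.card_insert_of_notMem hi, hk, hk']
  ring

/-- The vertices on which a variable depends. -/
def varSupport (n : ℕ) (q : PVar n) : Finset (Fin n) :=
  match q with
  | Sum.inl i => {i}
  | Sum.inr e => e.1.toFinset

lemma card_varSupport_le (n : ℕ) (q : PVar n) : (varSupport n q).card ≤ 2 := by
  rcases q with i | e
  · simp [varSupport]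
  · exact (Sym2.card_toFinset_of_not_isDiag e.1 e.2).le

lemma Xvar_insert (n : ℕ) (q : PVar n) {i : Fin n} (hi : i ∉ varSupport n q)
    (S : Finset (Fin n)) : Xvar n q (insert i S) = Xvar n q S := by
  rcases q with j | e
  · have hji : j ≠ i := fun h => hi (by simp [varSupport, h])
    simp [Xvar, hji]
  · have hie : i ∉ e.1 := fun h => hi (by simpa [varSupport] using h)
    simp [Xvar, hie]

lemma eventInd_insert (n : ℕ) (Y N : Finset (PVar n)) {i : Fin n}
    (hi : i ∉ (Y ∪ N).biUnion (varSupport n)) (S : Finset (Fin n)) :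
    eventInd n Y N (insert i S) = eventInd n Y N S := by
  have h : ∀ q ∈ Y ∪ N, Xvar n q (insert i S) = Xvar n q S := fun q hq =>
    Xvar_insert n q (fun hmem => hi (Finset.mem_biUnion.2 ⟨q, hq, hmem⟩)) S
  unfold eventInd
  congr 1
  · exact Finset.prod_congr rfl fun q hq => h q (Finset.mem_union_left _ hq)
  · exact Finset.prod_congr rfl fun q hq => by rw [h q (Finset.mem_union_right _ hq)]

lemma Xvar_vertex_le_edge (n : ℕ) (e : EdgeT n) {i : Fin n} (hi : i ∈ e.1)
    (S : Finset (Fin n)) : (if i ∈ S then 1 else 0) ≤ Xvar n (Sum.inr e) S := by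
  split_ifs with h
  · exact (if_pos ⟨i, h, hi⟩ : Xvar n (Sum.inr e) S = 1).ge
  · exact Xvar_nonneg n _ S

lemma Xvar_edge_le_add (n : ℕ) (e : EdgeT n) {i j : Fin n} (he : e.1 = s(i, j))
    (S : Finset (Fin n)) :
    Xvar n (Sum.inr e) S ≤ Xvar n (Sum.inl i) S + Xvar n (Sum.inl j) S := by
  simp only [Xvar, he, Sym2.mem_iff]
  by_cases hi : i ∈ S <;> by_cases hj : j ∈ S <;> simp [hi, hj, and_or_left, exists_or]

lemma choose_card_le_card_edges (n : ℕ) (W : Finset (Fin n)) :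
    W.card.choose 2 ≤ (Finset.univ.filter fun e : EdgeT n => ∀ i ∈ e.1, i ∈ W).card := by
  rw [← Sym2.card_image_offDiag W, ← Finset.card_map (Function.Embedding.subtype _)]
  refine Finset.card_le_card fun e he => ?_
  obtain ⟨⟨i, j⟩, hij, rfl⟩ := Finset.mem_image.1 he
  obtain ⟨hi, hj, hne⟩ := Finset.mem_offDiag.1 hij
  refine Finset.mem_map.2 ⟨⟨s(i, j), by simpa using hne⟩, ?_, rfl⟩
  simp only [Finset.mem_filter, Finset.mem_univ, true_and, Sym2.mem_iff]
  rintro k (rfl | rfl) <;> assumption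

lemma choose_mul_le_sum_edges {n : ℕ} {p : ℝ} (h0 : 0 ≤ p) (h1 : p ≤ 1) {r : ℕ}
    (Y N : Finset (PVar n)) (hr : (Y ∪ N).card ≤ r) :
    ((n - 2 * r).choose 2 : ℝ) * (p * ED n p (eventInd n Y N)) ≤
      ∑ e : EdgeT n, ED n p (eventInd n (Y ∪ {Sum.inr e}) N) := by
  set U := (Y ∪ N).biUnion (varSupport n)
  have hUcard : U.card ≤ 2 * r := by
    refine (Finset.card_biUnion_le_card_mul (Y ∪ N) (varSupport n) 2
      fun q _ => card_varSupport_le n q).trans ?_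
    omega
  have hcard : (n - 2 * r).choose 2 ≤
      (Finset.univ.filter fun e : EdgeT n => ∀ i ∈ e.1, i ∈ Uᶜ).card := by
    refine (Nat.choose_le_choose 2 ?_).trans (choose_card_le_card_edges n Uᶜ)
    rw [Finset.card_compl, Fintype.card_fin]
    omega
  have hE : 0 ≤ p * ED n p (eventInd n Y N) :=
    mul_nonneg h0 (ED_nonneg h0 h1 (eventInd_nonneg n Y N))
  calc ((n - 2 * r).choose 2 : ℝ) * (p * ED n p (eventInd n Y N))
      ≤ ((Finset.univ.filter fun e : EdgeT n => ∀ i ∈ e.1, i ∈ Uᶜ).card : ℝ) *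
          (p * ED n p (eventInd n Y N)) :=
        mul_le_mul_of_nonneg_right (by exact_mod_cast hcard) hE
    _ = (Finset.univ.filter fun e : EdgeT n => ∀ i ∈ e.1, i ∈ Uᶜ).card •
          (p * ED n p (eventInd n Y N)) := (nsmul_eq_mul _ _).symm
    _ ≤ ∑ e ∈ Finset.univ.filter (fun e : EdgeT n => ∀ i ∈ e.1, i ∈ Uᶜ),
          ED n p (eventInd n (Y ∪ {Sum.inr e}) N) := by
        refine Finset.card_nsmul_le_sum _ _ _ fun e he => ?_
        obtain ⟨i, hi⟩ : ∃ i, i ∈ e.1 := ⟨_, Sym2.out_fst_mem e.1⟩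
        have hiU : i ∉ U := Finset.mem_compl.1 ((Finset.mem_filter.1 he).2 i hi)
        rw [← ED_mul_mem n p i _ fun S _ => eventInd_insert n Y N hiU S]
        refine ED_mono h0 h1 fun S => ?_
        rw [eventInd_union_singleton]
        exact mul_le_mul_of_nonneg_right (Xvar_vertex_le_edge n e hi S)
          (eventInd_nonneg n Y N S)
    _ ≤ ∑ e : EdgeT n, ED n p (eventInd n (Y ∪ {Sum.inr e}) N) :=
        Finset.sum_le_sum_of_subset_of_nonneg (Finset.filter_subset _ _)
          fun e _ _ => ED_nonneg h0 h1 (eventInd_nonneg n _ N)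

lemma le_choose_two {n r t : ℕ} (hn : 2 * r + 2 * t + 2 ≤ n) :
    t + 1 ≤ (n - 2 * r).choose 2 := by
  calc t + 1 ≤ (2 * t + 2).choose 2 := by
        rw [Nat.choose_two_right, Nat.le_div_iff_mul_le two_pos,
          show 2 * t + 2 - 1 = 2 * t + 1 by omega]
        nlinarith
    _ ≤ (n - 2 * r).choose 2 := Nat.choose_le_choose 2 (by omega)

theorem stmt5 (n r t : ℕ) (ht : 1 ≤ t) (hn : 2 * r + 2 * t + 2 ≤ n) :
    SAmem n t r (yD n (pval n r t)) := by
  have hC : (t : ℝ) + 1 ≤ (n - 2 * r).choose 2 := by exact_mod_cast le_choose_two hn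
  have ht0 : (0 : ℝ) ≤ t := t.cast_nonneg
  have hCpos : (0 : ℝ) < (n - 2 * r).choose 2 := by linarith
  have h0 : 0 ≤ pval n r t := div_nonneg ht0 hCpos.le
  have h1 : pval n r t ≤ 1 := (div_le_one hCpos).2 (by linarith)
  have hp : ((n - 2 * r).choose 2 : ℝ) * pval n r t = t := mul_div_cancel₀ _ hCpos.ne'
  refine ⟨yD_empty n _, fun Y N hr => ?_⟩
  simp only [wSA_yD]
  refine ⟨fun e i j he => ?_, ?_, fun q => ⟨?_, ?_⟩⟩
  · rw [ge_iff_le, ED, ED, ED, ← Finset.sum_add_distrib]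
    refine Finset.sum_le_sum fun S _ => ?_
    rw [← mul_add]
    refine mul_le_mul_of_nonneg_left ?_ (μD_nonneg h0 h1 S)
    simp only [eventInd_union_singleton]
    rw [← add_mul]
    exact mul_le_mul_of_nonneg_right (Xvar_edge_le_add n e he S) (eventInd_nonneg n Y N S)
  · have h := choose_mul_le_sum_edges h0 h1 Y N hr
    rwa [← mul_assoc, hp] at h
  · exact ED_nonneg h0 h1 (eventInd_nonneg n _ N)
  · refine ED_mono h0 h1 fun S => ?_
    rw [eventInd_union_singleton]
    exact mul_le_of_le_one_left (eventInd_nonneg n Y N S) (Xvar_le_one n q S)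

end
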